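/- Let R be a commutative ring, let A and B be R-modules, and let v, h : A → B and ρ : B → A be R-linear maps such that v ∘ ρ = id_B and such that the composite N = ρ ∘ h : A → A is locally nilpotent (for every x ∈ A there exists m with N^m(x) = 0). Then the map id + ρ ∘ h restricts to an R-linear bijection from the kernel of v + h onto the kernel of v; equivalently, for every a ∈ A with v(a) = 0 there exists a unique a' ∈ A with a' + ρ(h(a')) = a, and this a' satisfies (v + h)(a') = 0. -/

import Mathlib

/-- If `v ∘ ρ = id` and `N = ρ ∘ h` is locally nilpotent, then `id + ρ ∘ h`
restricts to a bijection from `ker (v + h)` onto `ker v`; equivalently, for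
every `a` with `v a = 0` there is a unique `a'` with `a' + ρ (h a') = a`, and
this `a'` satisfies `(v + h) a' = 0`. -/
theorem id_add_rho_h_bijOn_ker
    (R : Type*) [CommRing R]
    (A B : Type*) [AddCommGroup A] [Module R A] [AddCommGroup B] [Module R B]
    (v h : A →ₗ[R] B) (ρ : B →ₗ[R] A)
    (hvρ : v ∘ₗ ρ = LinearMap.id)
    (hN : ∀ x : A, ∃ m : ℕ, ((ρ ∘ₗ h) ^ m) x = 0) :
    Set.BijOn (fun x : A => x + ρ (h x))
        (LinearMap.ker (v + h) : Set A) (LinearMap.ker v : Set A) ∧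
      ∀ a : A, v a = 0 →
        (∃! a' : A, a' + ρ (h a') = a) ∧
          ∀ a' : A, a' + ρ (h a') = a → (v + h) a' = 0 := by
  have hv : ∀ b, v (ρ b) = b := fun b => by
    have := LinearMap.congr_fun hvρ b
    simpa using this
  have key : ∀ x, v (x + ρ (h x)) = (v + h) x := fun x => by
    simp [hv]
  have inj0 : ∀ (m : ℕ) (x : A), ((ρ ∘ₗ h) ^ m) x = 0 → x + ρ (h x) = 0 → x = 0 := by
    intro m
    induction m with
    | zero => intro x hx _; simpa using hx
    | succ m ih =>
      intro x hx h0
      refine ih x ?_ h0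
      rw [pow_succ, Module.End.mul_apply, LinearMap.comp_apply,
        eq_neg_of_add_eq_zero_right h0, map_neg, neg_eq_zero] at hx
      exact hx
  have surj0 : ∀ (m : ℕ) (a : A), ((ρ ∘ₗ h) ^ m) a = 0 → ∃ a', a' + ρ (h a') = a := by
    intro m
    induction m with
    | zero =>
      intro a ha
      have ha0 : a = 0 := by simpa using ha
      exact ⟨0, by simp [ha0]⟩
    | succ m ih =>
      intro a ha
      rw [pow_succ, Module.End.mul_apply, LinearMap.comp_apply] at ha
      obtain ⟨b, hb⟩ := ih _ ha
      refine ⟨a - b, ?_⟩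
      rw [map_sub, map_sub, ← hb]
      abel
  have inj : ∀ x y : A, x + ρ (h x) = y + ρ (h y) → x = y := by
    intro x y hxy
    obtain ⟨m, hm⟩ := hN (x - y)
    refine sub_eq_zero.mp (inj0 m _ hm ?_)
    rw [map_sub, map_sub, ← sub_eq_zero.mpr hxy]
    abel
  have surj : ∀ a : A, ∃ a', a' + ρ (h a') = a := fun a => by
    obtain ⟨m, hm⟩ := hN a
    exact surj0 m a hm
  refine ⟨⟨?_, ?_, ?_⟩, ?_⟩
  · intro x hx
    exact (key x).trans hx
  · intro x _ y _ hxy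
    exact inj x y hxy
  · intro a ha
    obtain ⟨x, hx⟩ := surj a
    refine ⟨x, ?_, hx⟩
    have h1 : v a = 0 := ha
    have h2 : (v + h) x = 0 := by rw [← key, hx, h1]
    exact h2
  · intro a ha
    obtain ⟨x, hx⟩ := surj a
    refine ⟨⟨x, hx, fun y hy => inj y x (hy.trans hx.symm)⟩, ?_⟩
    intro y hy
    rw [← key, hy, ha]
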